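/- Let Ω ⊆ ℝⁿ be a bounded measurable set, let u : ℝⁿ → ℝ be measurable with the set {y ∈ Ω : u(y) ≠ 0} having positive Lebesgue measure, let b : ℝ → ℝ be measurable with 0 ≤ b(w) for all w, b(w) > 0 whenever w ≠ 0, and |b(w)| ≤ C_b for all w, and let f : ℝⁿ → ℝ be continuous with f(s) > 0 for all s ∈ ℝⁿ. Then there exists a constant p_min > 0 such that p(x) ≥ p_min for every x in the closure of Ω. -/

import Mathlib

open MeasureTheory

/-- Uniform positive lower bound `p_min > 0` for the kernel
`p(x) = ∫_{y ∈ Ω} b(u(y)) f(x − y) dy` on the closure of `Ω`. -/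
theorem kernel_uniform_lower_bound {n : ℕ} (Ω : Set (Fin n → ℝ)) (hΩm : MeasurableSet Ω)
    (hΩb : Bornology.IsBounded Ω)
    (u : (Fin n → ℝ) → ℝ) (hu : Measurable u)
    (hu0 : 0 < volume {y | y ∈ Ω ∧ u y ≠ 0})
    (b : ℝ → ℝ) (hb : Measurable b) (C_b : ℝ)
    (hbnonneg : ∀ w : ℝ, 0 ≤ b w) (hbpos : ∀ w : ℝ, w ≠ 0 → 0 < b w)
    (hbound : ∀ w : ℝ, |b w| ≤ C_b)
    (f : (Fin n → ℝ) → ℝ) (hf : Continuous f) (hfpos : ∀ s : Fin n → ℝ, 0 < f s) :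
    ∃ p_min : ℝ, 0 < p_min ∧
      ∀ x ∈ closure Ω, p_min ≤ ∫ y in Ω, b (u y) * f (x - y) := by
  have hK : IsCompact (closure Ω) := hΩb.isCompact_closure
  have hvol : volume Ω < ⊤ := hΩb.measure_lt_top
  have hne : (closure Ω).Nonempty := by
    obtain ⟨y, hy, -⟩ := nonempty_of_measure_ne_zero hu0.ne'
    exact ⟨y, subset_closure hy⟩
  obtain ⟨q, -, hq⟩ := (hK.prod hK).exists_isMinOn (hne.prod hne)
    (f := fun z : (Fin n → ℝ) × (Fin n → ℝ) => f (z.1 - z.2)) (by fun_prop)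
  have hbu : AEStronglyMeasurable (fun y => b (u y)) (volume.restrict Ω) :=
    (hb.comp hu).aestronglyMeasurable
  have hbu_le : ∀ᵐ y ∂volume.restrict Ω, ‖b (u y)‖ ≤ C_b :=
    Filter.Eventually.of_forall fun y => hbound (u y)
  have hbu_int : IntegrableOn (fun y => b (u y)) Ω :=
    IntegrableOn.of_bound hvol hbu C_b hbu_le
  have hbu_pos : 0 < ∫ y in Ω, b (u y) := by
    rw [setIntegral_pos_iff_support_of_nonneg_ae
      (Filter.Eventually.of_forall fun y => hbnonneg (u y)) hbu_int]
    exact hu0.trans_le (measure_mono fun y hy => ⟨(hbpos _ hy.2).ne', hy.1⟩)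
  refine ⟨(∫ y in Ω, b (u y)) * f (q.1 - q.2), mul_pos hbu_pos (hfpos _), fun x hx => ?_⟩
  have hf_int : IntegrableOn (fun y => f (x - y)) Ω :=
    (ContinuousOn.integrableOn_compact hK (by fun_prop)).mono_set subset_closure
  rw [← integral_mul_const]
  refine setIntegral_mono_on (hbu_int.mul_const _) (hf_int.bdd_mul hbu hbu_le) hΩm fun y hy => ?_
  exact mul_le_mul_of_nonneg_left
    (isMinOn_iff.mp hq (x, y) ⟨hx, subset_closure hy⟩) (hbnonneg _)
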